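/- arXiv:2209.10323 — 3 statements merged into one kernel-verified Lean document; each statement's English description precedes it below -/
import Mathlib

section
/- Let O be an occurrence net. Every finite configuration C of O contains a unique ⊆-maximal shaved configuration shv(C) (obtainable by repeatedly removing unchallenged crest events), and Ω_C = Ω_{shv(C)}. -/
/-- A net `N = (P,T,F)`: the flow relation is split into its
place-to-transition part `pt` and transition-to-place part `tp`. -/
structure Net (P T : Type) where
  pt : P → T → Prop
  tp : T → P → Prop

namespace Net

variable {P T : Type} (N : Net P T)

/-- Preset of a transition: `•t`. -/
def preT (t : T) : Set P := {p | N.pt p t}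
/-- Postset of a transition: `t•`. -/
def postT (t : T) : Set P := {p | N.tp t p}
/-- Preset of a place: `•p`. -/
def preP (p : P) : Set T := {t | N.tp t p}
/-- Postset of a place: `p•`. -/
def postP (p : P) : Set T := {t | N.pt p t}

/-- Transition `t` is enabled at marking `M` iff `•t ⊆ M`. -/
def enabled (M : Set P) (t : T) : Prop := N.preT t ⊆ M
/-- Firing `t` at `M` yields `(M \ •t) ∪ t•`. -/
def fire (M : Set P) (t : T) : Set P := (M \ N.preT t) ∪ N.postT t
/-- One firing step between markings. -/
def stepRel (M M' : Set P) : Prop := ∃ t : T, N.enabled M t ∧ M' = N.fire M t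
/-- Reachability between markings (finite firing sequences). -/
def reach (M M' : Set P) : Prop := Relation.ReflTransGen N.stepRel M M'

/-- `(N, M₀)` is safe. -/
def safe (M₀ : Set P) : Prop :=
  ∀ M : Set P, N.reach M₀ M → ∀ t : T, N.enabled M t → M ∩ N.postT t ⊆ N.preT t

/-- `FiringSeq M l M'`: the sequence `l` of transitions can fire from `M`, ending in `M'`. -/
inductive FiringSeq : Set P → List T → Set P → Prop
  | nil (M : Set P) : FiringSeq M [] M
  | cons {M : Set P} (t : T) {l : List T} {M' : Set P} :
      N.enabled M t → FiringSeq (N.fire M t) l M' → FiringSeq M (t :: l) M'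

/-- The underlying edge relation of the flow, on nodes `P ⊕ T`. -/
def edge : (P ⊕ T) → (P ⊕ T) → Prop
  | Sum.inl p, Sum.inr t => N.pt p t
  | Sum.inr t, Sum.inl p => N.tp t p
  | _, _ => False

/-- Causality: `x < y` via a nonempty directed path. -/
def ltN (x y : P ⊕ T) : Prop := Relation.TransGen N.edge x y
/-- `x ≤ y` iff `x < y` or `x = y`. -/
def leN (x y : P ⊕ T) : Prop := N.ltN x y ∨ x = y

/-- Direct conflict of transitions: `•u ∩ •v ≠ ∅`. -/
def dirConflict (u v : T) : Prop := (N.preT u ∩ N.preT v).Nonempty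
/-- Conflict of nodes `x # y`. -/
def conflict (x y : P ⊕ T) : Prop :=
  ∃ u v : T, u ≠ v ∧ N.leN (Sum.inr u) x ∧ N.leN (Sum.inr v) y ∧ N.dirConflict u v
/-- Concurrency of nodes. -/
def concurrent (x y : P ⊕ T) : Prop :=
  ¬ N.leN x y ∧ ¬ N.leN y x ∧ ¬ N.conflict x y
/-- A co-set: a set of pairwise concurrent places (conditions). -/
def coset (S : Set P) : Prop :=
  ∀ b ∈ S, ∀ b' ∈ S, b ≠ b' → N.concurrent (Sum.inl b) (Sum.inl b')

end Net

/-- An occurrence net `O = (B, E, F, c₀)`: conditions `B`, events `E`. -/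
structure OccNet (B E : Type) extends Net B E where
  c₀ : Set B
  lt_irrefl : ∀ x : B ⊕ E, ¬ toNet.ltN x x
  pre_subsingleton : ∀ b : B, (toNet.preP b).Subsingleton
  mem_c₀_iff : ∀ b : B, b ∈ c₀ ↔ toNet.preP b = ∅
  no_self_conflict : ∀ e : E, ¬ toNet.conflict (Sum.inr e) (Sum.inr e)
  finite_past : ∀ e : E, {x : B ⊕ E | toNet.leN x (Sum.inr e)}.Finite

namespace OccNet

variable {B E : Type} (O : OccNet B E)

/-- A configuration: a causally closed, conflict-free set of events. -/
def config (C : Set E) : Prop :=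
  (∀ e ∈ C, ∀ e' : E, O.toNet.ltN (Sum.inr e') (Sum.inr e) → e' ∈ C) ∧
  (∀ e ∈ C, ∀ e' ∈ C, ¬ O.toNet.conflict (Sum.inr e) (Sum.inr e'))

/-- A run: a `⊆`-maximal configuration. -/
def run (ω : Set E) : Prop :=
  O.config ω ∧ ∀ C : Set E, O.config C → ω ⊆ C → C = ω

/-- `cut C = (c₀ ∪ C•) \ •C`. -/
def cut (C : Set E) : Set B :=
  (O.c₀ ∪ {b | ∃ e ∈ C, O.toNet.tp e b}) \ {b | ∃ e ∈ C, O.toNet.pt b e}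

/-- Event `e` is enabled by configuration `C`. -/
def enabledBy (C : Set E) (e : E) : Prop := e ∉ C ∧ O.config (C ∪ {e})

/-- `crest C`: the `<`-maximal events of `C`. -/
def crest (C : Set E) : Set E :=
  {e | e ∈ C ∧ ¬ ∃ e' ∈ C, O.toNet.ltN (Sum.inr e) (Sum.inr e')}

/-- The stump `⌊e⌋ = {e' : e' < e}` of an event. -/
def stump (e : E) : Set E := {e' | O.toNet.ltN (Sum.inr e') (Sum.inr e)}

/-- `spoiler e e'`: `e'` is a spoiler of `e`, i.e. `•e' ∩ •e ≠ ∅`. -/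
def spoiler (e e' : E) : Prop := (O.toNet.preT e' ∩ O.toNet.preT e).Nonempty

/-- An event is unchallenged iff no other event shares a precondition with it. -/
def unchallenged (e : E) : Prop :=
  ¬ ∃ e' : E, e' ≠ e ∧ (O.toNet.preT e' ∩ O.toNet.preT e).Nonempty

/-- A configuration is shaved iff its crest contains no unchallenged event. -/
def shaved (C : Set E) : Prop := ∀ e ∈ O.crest C, ¬ O.unchallenged e

/-- Strict `C`-conflict `e #^C e'`: `e ≠ e'`, `•e ∩ •e' ≠ ∅`, and `⌊e'⌋ ⊆ C`. -/
def strictConflict (C : Set E) (e e' : E) : Prop :=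
  e ≠ e' ∧ (O.toNet.preT e ∩ O.toNet.preT e').Nonempty ∧ O.stump e' ⊆ C

/-- Decisional height `δ(C)`: the number of events of `C` in strict `C`-conflict
with some event. -/
noncomputable def dHeight (C : Set E) : ℕ :=
  {e | e ∈ C ∧ ∃ e' : E, O.strictConflict C e e'}.ncard

end OccNet

/-- The unfolding `U = U(N, M₀)` of a Petri net `(N, M₀)`: an occurrence net with
conditions `B` and events `E`, together with the folding map (`fB` on conditions,
`fE` on events), satisfying the defining properties of the inductive construction:
the initial cut corresponds bijectively to `M₀`; the preset of an event `e` is a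
co-set folded bijectively onto `•f(e)` and its postset is folded bijectively onto
`f(e)•`; events are uniquely determined by (preset, label) and exist for every
co-set folding onto some `•t`; conditions are uniquely determined by
(producing event, label). -/
structure Unfolding (P T : Type) (N : Net P T) (M₀ : Set P) (B E : Type) where
  occ : OccNet B E
  fB : B → P
  fE : E → T
  init_bij : Set.BijOn fB occ.c₀ M₀
  pre_coset : ∀ e : E, occ.toNet.coset (occ.toNet.preT e)
  pre_bij : ∀ e : E, Set.BijOn fB (occ.toNet.preT e) (N.preT (fE e))
  post_bij : ∀ e : E, Set.BijOn fB (occ.toNet.postT e) (N.postT (fE e))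
  event_unique : ∀ e e' : E,
    occ.toNet.preT e = occ.toNet.preT e' → fE e = fE e' → e = e'
  event_exists : ∀ (S : Set B) (t : T), occ.toNet.coset S → Set.BijOn fB S (N.preT t) →
    ∃ e : E, occ.toNet.preT e = S ∧ fE e = t
  cond_unique : ∀ b b' : B,
    occ.toNet.preP b = occ.toNet.preP b' → fB b = fB b' → b = b'

/-- `Bad` is reachability-closed: `M ∈ Bad` and `M → M'` imply `M' ∈ Bad`. -/
def ReachClosed {P T : Type} (N : Net P T) (Bad : Set (Set P)) : Prop :=
  ∀ M ∈ Bad, ∀ M' : Set P, N.reach M M' → M' ∈ Bad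

namespace Unfolding

variable {P T B E : Type} {N : Net P T} {M₀ : Set P} (U : Unfolding P T N M₀ B E)

/-- `Mark C = f(cut C)`. -/
def Mark (C : Set E) : Set P := U.fB '' U.occ.cut C

/-- A finite configuration is doomed iff every run extending it contains a finite
configuration (extending it) whose marking is bad. -/
def doomed (Bad : Set (Set P)) (C : Set E) : Prop :=
  ∀ ω : Set E, U.occ.run ω → C ⊆ ω →
    ∃ C' : Set E, C'.Finite ∧ U.occ.config C' ∧ C ⊆ C' ∧ C' ⊆ ω ∧ U.Mark C' ∈ Bad

/-- A configuration is free iff it is not doomed. -/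
def free (Bad : Set (Set P)) (C : Set E) : Prop := ¬ U.doomed Bad C

/-- A finite configuration is minimally doomed iff it is doomed and no proper
sub-configuration of it is doomed. -/
def minDoomed (Bad : Set (Set P)) (C : Set E) : Prop :=
  C.Finite ∧ U.occ.config C ∧ U.doomed Bad C ∧
  ∀ C' : Set E, C' ⊂ C → U.occ.config C' → ¬ U.doomed Bad C'

/-- A (finite) prefix of the unfolding: a finite, causally closed set of events. -/
def isPrefix (E' : Set E) : Prop :=
  E'.Finite ∧ ∀ e ∈ E', ∀ e' : E, U.occ.toNet.ltN (Sum.inr e') (Sum.inr e) → e' ∈ E'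

/-- A complete prefix `Π₀` of the unfolding. -/
def isCompletePrefix (E' : Set E) : Prop :=
  U.isPrefix E' ∧
  ∀ M : Set P, N.reach M₀ M →
    ∃ C : Set E, U.occ.config C ∧ C ⊆ E' ∧ U.Mark C = M ∧
      ∀ t : T, N.enabled M t → ∃ e ∈ E', U.fE e = t ∧ U.occ.enabledBy C e

/-- `isPi1 E₀ E₁`: `E₀` is a complete prefix `Π₀` and `E₁` is the prefix `Π₁`
obtained by appending, after every `⊆`-maximal configuration `Cm` of `Π₀`, a
complete prefix of the unfolding of `(N, Mark Cm)`. -/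
def isPi1 (E₀ E₁ : Set E) : Prop :=
  U.isCompletePrefix E₀ ∧ U.isPrefix E₁ ∧ E₀ ⊆ E₁ ∧
  ∀ Cm : Set E, U.occ.config Cm → Cm ⊆ E₀ →
    (∀ C' : Set E, U.occ.config C' → C' ⊆ E₀ → Cm ⊆ C' → C' = Cm) →
    ∀ M : Set P, N.reach (U.Mark Cm) M →
      ∃ C : Set E, U.occ.config C ∧ Cm ⊆ C ∧ C ⊆ E₁ ∧ U.Mark C = M ∧
        ∀ t : T, N.enabled M t → ∃ e ∈ E₁, U.fE e = t ∧ U.occ.enabledBy C e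

end Unfolding

namespace Net

variable {P T : Type} {N : Net P T}

theorem ltN.trans_leN {x y z : P ⊕ T} (h : N.ltN x y) (h' : N.leN y z) : N.ltN x z := by
  rcases h' with h' | rfl
  · exact Relation.TransGen.trans h h'
  · exact h

theorem leN_refl (x : P ⊕ T) : N.leN x x := Or.inr rfl

end Net

namespace OccNet

variable {B E : Type} (O : OccNet B E)

/-- The events of `C` lying causally below some challenged event of `C`. -/
def shv (C : Set E) : Set E :=
  {e | e ∈ C ∧ ∃ f ∈ C, O.toNet.leN (Sum.inr e) (Sum.inr f) ∧ ¬ O.unchallenged f}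

variable {O} {C S ω : Set E}

theorem config.mem_of_leN (hC : O.config C) {e f : E} (hf : f ∈ C)
    (h : O.toNet.leN (Sum.inr e) (Sum.inr f)) : e ∈ C := by
  rcases h with h | h
  · exact hC.1 f hf e h
  · exact Sum.inr.inj h ▸ hf

theorem config.eq_of_dirConflict (hC : O.config C) {u v : E} (hu : u ∈ C) (hv : v ∈ C)
    (h : O.toNet.dirConflict u v) : u = v := by
  by_contra hne
  exact hC.2 u hu v hv ⟨u, v, hne, Net.leN_refl _, Net.leN_refl _, h⟩

theorem exists_mem_crest_leN (hfin : C.Finite) {e : E} (he : e ∈ C) :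
    ∃ f ∈ O.crest C, O.toNet.leN (Sum.inr e) (Sum.inr f) := by
  have : IsStrictOrder E fun a b => O.toNet.ltN (Sum.inr b) (Sum.inr a) :=
    { irrefl := fun a => O.lt_irrefl _
      trans := fun _ _ _ hab hbc => Relation.TransGen.trans hbc hab }
  refine (hfin.wellFoundedOn (r := fun a b => O.toNet.ltN (Sum.inr b) (Sum.inr a))).induction
    (P := fun e => ∃ f ∈ O.crest C, O.toNet.leN (Sum.inr e) (Sum.inr f)) he fun a ha ih => ?_
  by_cases h : ∃ a' ∈ C, O.toNet.ltN (Sum.inr a) (Sum.inr a')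
  · obtain ⟨a', ha', hlt⟩ := h
    obtain ⟨f, hf, hle⟩ := ih a' ha' hlt
    exact ⟨f, hf, Or.inl (hlt.trans_leN hle)⟩
  · exact ⟨a, ⟨ha, h⟩, Net.leN_refl _⟩

theorem shv_subset : O.shv C ⊆ C := fun _ h => h.1

theorem config.shv (hC : O.config C) : O.config (O.shv C) := by
  refine ⟨?_, fun e he e' he' => hC.2 e he.1 e' he'.1⟩
  rintro e ⟨he, f, hf, hef, hch⟩ e' hlt
  exact ⟨hC.1 e he e' hlt, f, hf, Or.inl (Net.ltN.trans_leN hlt hef), hch⟩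

theorem shaved_shv : O.shaved (O.shv C) := by
  rintro e ⟨⟨-, f, hf, hef | hef, hch⟩, hmax⟩
  · exact (hmax ⟨f, ⟨hf, f, hf, Net.leN_refl _, hch⟩, hef⟩).elim
  · exact Sum.inr.inj hef ▸ hch

theorem shaved.subset_shv (hS : O.shaved S) (hSC : S ⊆ C) (hfin : C.Finite) :
    S ⊆ O.shv C := by
  intro e he
  obtain ⟨f, hf, hef⟩ := exists_mem_crest_leN (O := O) (hfin.subset hSC) he
  exact ⟨hSC he, f, hSC hf.1, hef, hS f hf⟩

theorem mem_shv_of_dirConflict {u v : E} (hu : u ∈ C) (hne : u ≠ v)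
    (h : O.toNet.dirConflict u v) : u ∈ O.shv C :=
  ⟨hu, u, hu, Net.leN_refl _, fun hun => hun ⟨v, hne.symm, h.mono fun _ hb => ⟨hb.2, hb.1⟩⟩⟩

theorem config.union_of_shv_subset (hC : O.config C) (hω : O.config ω) (h : O.shv C ⊆ ω) :
    O.config (ω ∪ C) := by
  refine ⟨fun e he e' hlt => he.imp (fun he => hω.1 e he e' hlt) fun he => hC.1 e he e' hlt, ?_⟩
  rintro e he e' he' ⟨u, v, hne, hu, hv, huv⟩
  have hvu : O.toNet.dirConflict v u := huv.mono fun _ hb => ⟨hb.2, hb.1⟩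
  have hu' : u ∈ ω :=
    he.elim (fun he => hω.mem_of_leN he hu)
      fun he => h (mem_shv_of_dirConflict (hC.mem_of_leN he hu) hne huv)
  have hv' : v ∈ ω :=
    he'.elim (fun he' => hω.mem_of_leN he' hv)
      fun he' => h (mem_shv_of_dirConflict (hC.mem_of_leN he' hv) hne.symm hvu)
  exact hne (hω.eq_of_dirConflict hu' hv' huv)

theorem run.subset_iff_shv_subset (hω : O.run ω) (hC : O.config C) :
    C ⊆ ω ↔ O.shv C ⊆ ω :=
  ⟨shv_subset.trans, fun h => Set.union_eq_left.mp <|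
    hω.2 _ (hC.union_of_shv_subset hω.1 h) Set.subset_union_left⟩

end OccNet

/-- every finite configuration `C` of an occurrence net contains a
unique `⊆`-maximal shaved configuration `shv C`, and `C` and `shv C` are
contained in exactly the same runs. -/
theorem exists_unique_maximal_shaved
    {B E : Type} (O : OccNet B E)
    (C : Set E) (hfin : C.Finite) (hC : O.config C) :
    ∃ S : Set E,
      (S ⊆ C ∧ O.config S ∧ O.shaved S ∧
        ∀ S' : Set E, S' ⊆ C → O.config S' → O.shaved S' → S ⊆ S' → S' = S) ∧
      (∀ S'' : Set E,
        (S'' ⊆ C ∧ O.config S'' ∧ O.shaved S'' ∧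
          ∀ S' : Set E, S' ⊆ C → O.config S' → O.shaved S' → S'' ⊆ S' → S' = S'') →
        S'' = S) ∧
      (∀ ω : Set E, O.run ω → (C ⊆ ω ↔ S ⊆ ω)) := by
  refine ⟨O.shv C, ⟨OccNet.shv_subset, hC.shv, OccNet.shaved_shv,
    fun S' hS'C _ hS' h => (hS'.subset_shv hS'C hfin).antisymm h⟩, ?_,
    fun ω hω => hω.subset_iff_shv_subset hC⟩
  rintro S ⟨hSC, -, hS, hmax⟩
  exact (hmax _ OccNet.shv_subset hC.shv OccNet.shaved_shv (hS.subset_shv hSC hfin)).symm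
end

section
/- Let (N,M₀) be a safe Petri net with unfolding U and B⊆2^P reachability-closed. Doomedness is upward closed: if a finite configuration C of U is doomed and C'' is a finite configuration with C⊆C'', then C'' is doomed. -/
namespace OccNet

variable {B E : Type} (O : OccNet B E)

theorem ltN_of_tp_pt {e e' : E} {b : B} (h : O.toNet.tp e b) (h' : O.toNet.pt b e') :
    O.toNet.ltN (Sum.inr e) (Sum.inr e') :=
  Relation.TransGen.tail (b := Sum.inl b) (Relation.TransGen.single h) h'

theorem conflict_of_pt {e e' : E} {b : B} (hne : e ≠ e') (h : O.toNet.pt b e)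
    (h' : O.toNet.pt b e') : O.toNet.conflict (Sum.inr e) (Sum.inr e') :=
  ⟨e, e', hne, Or.inr rfl, Or.inr rfl, b, h, h'⟩

theorem exists_maximal_event {S : Set E} (hS : S.Finite) (hne : S.Nonempty) :
    ∃ e ∈ S, ∀ e' ∈ S, ¬ O.toNet.ltN (Sum.inr e) (Sum.inr e') := by
  let r : E → E → Prop := fun a b => O.toNet.ltN (Sum.inr b) (Sum.inr a)
  have : IsStrictOrder E r :=
    { irrefl := fun a => O.lt_irrefl _
      trans := fun _ _ _ h h' => Relation.TransGen.trans h' h }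
  have hwf : S.WellFoundedOn r := hS.wellFoundedOn
  obtain ⟨x, hx⟩ := hne
  obtain ⟨m, -, hm⟩ := WellFounded.has_min hwf Set.univ ⟨⟨x, hx⟩, trivial⟩
  exact ⟨m, m.2, fun e' he' => hm ⟨e', he'⟩ trivial⟩

/-- Induction over the finite configurations extending `C`, adding one event at a time. -/
theorem config_induction {C : Set E} (hC : O.config C) {motive : Set E → Prop}
    (base : motive C)
    (step : ∀ (D : Set E) (e : E), O.config D → e ∉ D → O.config (insert e D) →
      motive D → motive (insert e D))
    {D : Set E} (hfin : D.Finite) (hD : O.config D) (hsub : C ⊆ D) : motive D := by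
  induction hn : D.ncard generalizing D with
  | zero =>
    obtain rfl := (Set.ncard_eq_zero hfin).1 hn
    rwa [← Set.subset_empty_iff.1 hsub]
  | succ n ih =>
    by_cases hDC : (D \ C).Nonempty
    · obtain ⟨e, ⟨heD, heC⟩, hmax⟩ := O.exists_maximal_event hfin.sdiff hDC
      have hmax' : ∀ e' ∈ D, ¬ O.toNet.ltN (Sum.inr e) (Sum.inr e') := fun e' he' hlt =>
        hmax e' ⟨he', fun h => heC (hC.1 e' h e hlt)⟩ hlt
      have hcfg : O.config (D \ {e}) :=
        ⟨fun a ha a' hlt => ⟨hD.1 a ha.1 a' hlt, fun h => hmax' a ha.1 (h ▸ hlt)⟩,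
          fun a ha a' ha' => hD.2 a ha.1 a' ha'.1⟩
      have hins : insert e (D \ {e}) = D := Set.insert_sdiff_self_of_mem heD
      have hcard : (D \ {e}).ncard = n := by
        rw [Set.ncard_sdiff_singleton_of_mem heD, hn]; rfl
      have := step (D \ {e}) e hcfg (fun h => h.2 rfl) (hins.symm ▸ hD)
        (ih hfin.sdiff hcfg (fun a ha => ⟨hsub ha, fun h => heC (h ▸ ha)⟩) hcard)
      rwa [hins] at this
    · have : D ⊆ C := Set.sdiff_eq_empty.1 (Set.not_nonempty_iff_eq_empty.1 hDC)
      rwa [this.antisymm hsub]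

theorem preT_subset_cut {C : Set E} {e : E} (he : e ∉ C) (hCe : O.config (insert e C)) :
    O.toNet.preT e ⊆ O.cut C := by
  intro b hb
  refine ⟨?_, ?_⟩
  · by_cases h : (O.toNet.preP b) = ∅
    · exact Or.inl ((O.mem_c₀_iff b).2 h)
    · obtain ⟨a, ha⟩ := Set.nonempty_iff_ne_empty.2 h
      have hlt := O.ltN_of_tp_pt ha hb
      rcases hCe.1 e (Set.mem_insert e C) a hlt with rfl | haC
      · exact absurd hlt (O.lt_irrefl _)
      · exact Or.inr ⟨a, haC, ha⟩
  · rintro ⟨a, haC, hab⟩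
    exact hCe.2 a (Or.inr haC) e (Or.inl rfl)
      (O.conflict_of_pt (fun h => he (h ▸ haC)) hab hb)

theorem cut_insert {C : Set E} {e : E} (hC : O.config C) (he : e ∉ C) :
    O.cut (insert e C) = (O.cut C \ O.toNet.preT e) ∪ O.toNet.postT e := by
  ext b
  constructor
  · rintro ⟨hb, hb'⟩
    have hC' : ¬ ∃ a ∈ C, O.toNet.pt b a := fun ⟨a, ha, h⟩ => hb' ⟨a, Or.inr ha, h⟩
    have he' : b ∉ O.toNet.preT e := fun h => hb' ⟨e, Or.inl rfl, h⟩
    rcases hb with hb | ⟨a, rfl | ha, hab⟩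
    · exact Or.inl ⟨⟨Or.inl hb, hC'⟩, he'⟩
    · exact Or.inr hab
    · exact Or.inl ⟨⟨Or.inr ⟨a, ha, hab⟩, hC'⟩, he'⟩
  · rintro (⟨⟨hb, hb'⟩, hbe⟩ | hb)
    · refine ⟨hb.imp id fun ⟨a, ha, h⟩ => ⟨a, Or.inr ha, h⟩, ?_⟩
      rintro ⟨a, rfl | ha, hab⟩
      · exact hbe hab
      · exact hb' ⟨a, ha, hab⟩
    · refine ⟨Or.inr ⟨e, Or.inl rfl, hb⟩, ?_⟩
      rintro ⟨a, rfl | ha, hab⟩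
      · exact O.lt_irrefl _ (O.ltN_of_tp_pt hb hab)
      · exact he (hC.1 a ha e (O.ltN_of_tp_pt hb hab))

theorem cut_empty : O.cut ∅ = O.c₀ := by
  simp [cut]

theorem config_empty : O.config ∅ :=
  ⟨fun _ h => h.elim, fun _ h => h.elim⟩

theorem config_union_of_subset {C D ω : Set E} (hC : O.config C) (hD : O.config D)
    (hω : O.config ω) (hCω : C ⊆ ω) (hDω : D ⊆ ω) : O.config (C ∪ D) :=
  ⟨fun a ha a' hlt => ha.imp (fun h => hC.1 a h a' hlt) (fun h => hD.1 a h a' hlt),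
    fun a ha a' ha' => hω.2 a (Set.union_subset hCω hDω ha) a' (Set.union_subset hCω hDω ha')⟩

end OccNet

namespace Unfolding

variable {P T B E : Type} {N : Net P T} {M₀ : Set P} (U : Unfolding P T N M₀ B E)

theorem enabled_Mark {C : Set E} {e : E} (he : e ∉ C) (hCe : U.occ.config (insert e C)) :
    N.enabled (U.Mark C) (U.fE e) := by
  unfold Net.enabled
  rw [← (U.pre_bij e).image_eq]
  exact Set.image_mono (U.occ.preT_subset_cut he hCe)

theorem Mark_insert {C : Set E} {e : E} (hC : U.occ.config C) (he : e ∉ C)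
    (hCe : U.occ.config (insert e C)) (hinj : Set.InjOn U.fB (U.occ.cut C)) :
    U.Mark (insert e C) = N.fire (U.Mark C) (U.fE e) := by
  have hpre := U.occ.preT_subset_cut he hCe
  rw [Mark, U.occ.cut_insert hC he, Set.image_union, (U.post_bij e).image_eq,
    hinj.image_sdiff_subset hpre, (U.pre_bij e).image_eq]
  rfl

theorem stepRel_Mark_insert {C : Set E} {e : E} (hC : U.occ.config C) (he : e ∉ C)
    (hCe : U.occ.config (insert e C)) (hinj : Set.InjOn U.fB (U.occ.cut C)) :
    N.stepRel (U.Mark C) (U.Mark (insert e C)) :=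
  ⟨U.fE e, U.enabled_Mark he hCe, U.Mark_insert hC he hCe hinj⟩

theorem injOn_cut_insert (hsafe : N.safe M₀) {C : Set E} {e : E} (hC : U.occ.config C)
    (he : e ∉ C) (hCe : U.occ.config (insert e C)) (hinj : Set.InjOn U.fB (U.occ.cut C))
    (hreach : N.reach M₀ (U.Mark C)) : Set.InjOn U.fB (U.occ.cut (insert e C)) := by
  have hnew : ∀ b ∈ U.occ.cut C \ U.occ.toNet.preT e, ∀ b' ∈ U.occ.toNet.postT e,
      U.fB b ≠ U.fB b' := by
    rintro b ⟨hb, hbe⟩ b' hb' heq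
    have hp : U.fB b ∈ N.preT (U.fE e) :=
      hsafe _ hreach _ (U.enabled_Mark he hCe)
        ⟨Set.mem_image_of_mem _ hb, heq ▸ (U.post_bij e).mapsTo hb'⟩
    obtain ⟨b₁, hb₁, h₁⟩ := (U.pre_bij e).surjOn hp
    exact hbe (hinj (U.occ.preT_subset_cut he hCe hb₁) hb h₁ ▸ hb₁)
  rw [U.occ.cut_insert hC he]
  rintro b (hb | hb) b' (hb' | hb') heq
  · exact hinj hb.1 hb'.1 heq
  · exact absurd heq (hnew b hb b' hb')
  · exact absurd heq.symm (hnew b' hb' b hb)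
  · exact (U.post_bij e).injOn hb hb' heq

/-- In the unfolding of a safe net, the cut of a finite configuration folds injectively
onto a reachable marking. -/
theorem injOn_cut_and_reach_Mark (hsafe : N.safe M₀) {C : Set E} (hfin : C.Finite)
    (hC : U.occ.config C) : Set.InjOn U.fB (U.occ.cut C) ∧ N.reach M₀ (U.Mark C) := by
  refine U.occ.config_induction U.occ.config_empty
    (motive := fun C => Set.InjOn U.fB (U.occ.cut C) ∧ N.reach M₀ (U.Mark C))
    ?_ ?_ hfin hC (Set.empty_subset C)
  · rw [Mark, U.occ.cut_empty, U.init_bij.image_eq]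
    exact ⟨U.init_bij.injOn, Relation.ReflTransGen.refl⟩
  · rintro D e hD he hDe ⟨hinj, hreach⟩
    exact ⟨U.injOn_cut_insert hsafe hD he hDe hinj hreach,
      hreach.tail (U.stepRel_Mark_insert hD he hDe hinj)⟩

theorem reach_Mark_of_subset (hsafe : N.safe M₀) {C D : Set E} (hC : U.occ.config C)
    (hfin : D.Finite) (hD : U.occ.config D) (hsub : C ⊆ D) :
    N.reach (U.Mark C) (U.Mark D) := by
  have hCfin := hfin.subset hsub
  refine (U.occ.config_induction hC
    (motive := fun D => D.Finite ∧ N.reach (U.Mark C) (U.Mark D))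
    ⟨hCfin, Relation.ReflTransGen.refl⟩ ?_ hfin hD hsub).2
  rintro D e hD he hDe ⟨hDfin, hreach⟩
  exact ⟨hDfin.insert e, hreach.tail (U.stepRel_Mark_insert hD he hDe
    (U.injOn_cut_and_reach_Mark hsafe hDfin hD).1)⟩

end Unfolding

/-- doomedness is upward closed: if a finite configuration `C` of
the unfolding is doomed and `C''` is a finite configuration with `C ⊆ C''`,
then `C''` is doomed. -/
theorem doomed_upward_closed
    {P T B E : Type} [Finite P] [Finite T]
    (N : Net P T) (M₀ : Set P) (hsafe : N.safe M₀)
    (U : Unfolding P T N M₀ B E)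
    (Bad : Set (Set P)) (hBad : ReachClosed N Bad)
    (C C'' : Set E) (hfin : C.Finite) (hC : U.occ.config C)
    (hfin'' : C''.Finite) (hC'' : U.occ.config C'')
    (hsub : C ⊆ C'') (hdoomed : U.doomed Bad C) :
    U.doomed Bad C'' := by
  intro ω hω hC''ω
  obtain ⟨C', hfin', hC', -, hC'ω, hbad⟩ := hdoomed ω hω (hsub.trans hC''ω)
  have hcfg := U.occ.config_union_of_subset hC' hC'' hω.1 hC'ω hC''ω
  exact ⟨C' ∪ C'', hfin'.union hfin'', hcfg, Set.subset_union_right,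
    Set.union_subset hC'ω hC''ω, hBad _ hbad _
      (U.reach_Mark_of_subset hsafe hC' (hfin'.union hfin'') hcfg Set.subset_union_left)⟩
end

section
/- Let (N,M₀) be a safe Petri net with unfolding U and B⊆2^P reachability-closed. Every minimally doomed configuration of U is shaved, i.e. its crest contains no unchallenged event. -/
namespace Net

theorem conflict.symm {P T : Type} {N : Net P T} {x y : P ⊕ T} (h : N.conflict x y) :
    N.conflict y x := by
  obtain ⟨u, v, huv, hu, hv, p, hpu, hpv⟩ := h
  exact ⟨v, u, huv.symm, hv, hu, p, hpv, hpu⟩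

end Net

namespace OccNet

variable {B E : Type} {O : OccNet B E}

/-- Removing a `<`-maximal event from a configuration leaves a configuration. -/
theorem config.sdiff_crest {C : Set E} (hC : O.config C) {e : E} (he : e ∈ O.crest C) :
    O.config (C \ {e}) := by
  refine ⟨fun a ha b hb => ⟨hC.1 a ha.1 b hb, ?_⟩, fun a ha b hb => hC.2 a ha.1 b hb.1⟩
  rintro rfl
  exact he.2 ⟨a, ha.1, hb⟩

/-- An unchallenged event is in conflict with no event of a configuration containing its stump. -/
theorem unchallenged.not_conflict {ω : Set E} (hω : O.config ω) {e : E} (he : O.unchallenged e)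
    (hs : O.stump e ⊆ ω) {x : E} (hx : x ∈ ω) :
    ¬ O.toNet.conflict (Sum.inr e) (Sum.inr x) := by
  rintro ⟨u, v, huv, hu | hu, hv, p, hpu, hpv⟩
  · exact hω.2 u (hs hu) x hx ⟨u, v, huv, Or.inr rfl, hv, p, hpu, hpv⟩
  · obtain rfl := Sum.inr.inj hu
    exact he ⟨v, huv.symm, p, hpv, hpu⟩

/-- A run contains every unchallenged event whose stump it contains. -/
theorem run.mem_of_unchallenged {ω : Set E} (hω : O.run ω) {e : E} (he : O.unchallenged e)
    (hs : O.stump e ⊆ ω) : e ∈ ω := by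
  have hconf : O.config (insert e ω) := by
    refine ⟨?_, ?_⟩
    · rintro a (rfl | ha) b hb
      · exact Or.inr (hs hb)
      · exact Or.inr (hω.1.1 a ha b hb)
    · rintro a (rfl | ha) b (rfl | hb)
      · exact O.no_self_conflict _
      · exact he.not_conflict hω.1 hs hb
      · exact fun h => he.not_conflict hω.1 hs ha h.symm
      · exact hω.1.2 a ha b hb
  exact hω.2 _ hconf (Set.subset_insert e ω) ▸ Set.mem_insert e ω

end OccNet

/-- every minimally doomed configuration of the unfolding is
shaved, i.e. its crest contains no unchallenged event. -/
theorem minDoomed_shaved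
    {P T B E : Type} [Finite P] [Finite T]
    (N : Net P T) (M₀ : Set P) (hsafe : N.safe M₀)
    (U : Unfolding P T N M₀ B E)
    (Bad : Set (Set P)) (hBad : ReachClosed N Bad)
    (C : Set E) (hmin : U.minDoomed Bad C) :
    U.occ.shaved C := by
  intro e he hunch
  obtain ⟨-, hC, hdoom, hminimal⟩ := hmin
  refine hminimal (C \ {e}) (Set.sdiff_singleton_ssubset.2 he.1) (hC.sdiff_crest he) ?_
  intro ω hω hsub
  have hs : U.occ.stump e ⊆ ω := fun a ha =>
    hsub ⟨hC.1 e he.1 a ha, fun h => U.occ.lt_irrefl _ ((show a = e from h) ▸ ha)⟩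
  have hCω : C ⊆ ω := fun a ha => by
    by_cases h : a = e
    · exact h ▸ hω.mem_of_unchallenged hunch hs
    · exact hsub ⟨ha, h⟩
  obtain ⟨C', hfin, hconf, hCC', hC'ω, hbad⟩ := hdoom ω hω hCω
  exact ⟨C', hfin, hconf, Set.sdiff_subset.trans hCC', hC'ω, hbad⟩
end
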